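/- Let n ≥ 2, and let A and B be (n+1)×(n+1) matrices with nonnegative integer entries that are invertible Calabi–Yau and have the same dual weights (q_0,…,q_n). Then for every prime power q and every ψ ∈ F_q, the numbers of F_q-rational points of the projective hypersurfaces X_{A,ψ} and X_{B,ψ} in ℙ^n are congruent modulo q: #X_{A,ψ}(F_q) ≡ #X_{B,ψ}(F_q) (mod q). -/

import Mathlib

open MvPolynomial Polynomial
open scoped BigOperators

noncomputable section

/-- The polynomial `F_A = ∑_i ∏_j x_j^(a_(ij))` attached to a matrix of exponents `A`. -/
def FA {n : ℕ} (R : Type*) [CommRing R] (A : Matrix (Fin (n+1)) (Fin (n+1)) ℕ) :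
    MvPolynomial (Fin (n+1)) R :=
  ∑ i : Fin (n+1), ∏ j : Fin (n+1), (X j : MvPolynomial (Fin (n+1)) R) ^ A i j

/-- `A` is invertible Calabi–Yau: `det A ≠ 0`, all row sums equal `n+1` (so `F_A` is
homogeneous of degree `n+1`), and the only critical point of `F_A : ℂ^(n+1) → ℂ` is the
origin. -/
def IsInvertibleCY {n : ℕ} (A : Matrix (Fin (n+1)) (Fin (n+1)) ℕ) : Prop :=
  (A.map (Nat.cast : ℕ → ℚ)).det ≠ 0 ∧
  (∀ i, ∑ j, A i j = n + 1) ∧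
  (∀ x : Fin (n+1) → ℂ,
    (∀ i, MvPolynomial.eval x (MvPolynomial.pderiv i (FA ℂ A)) = 0) ↔ x = 0)

/-- `q` is the tuple of dual weights of `A`: positive, primitive, and
`∑_j a_(ji) q_j = d^T := ∑_j q_j` for all `i`. -/
def HasDualWeights {n : ℕ} (A : Matrix (Fin (n+1)) (Fin (n+1)) ℕ)
    (q : Fin (n+1) → ℕ) : Prop :=
  (∀ i, 0 < q i) ∧ Finset.univ.gcd q = 1 ∧
  (∀ i, ∑ j, A j i * q j = ∑ j, q j)

/-- The invertible pencil `F_(A,ψ) = F_A - d^T · ψ · x_0 ⋯ x_n`. -/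
def pencil {n : ℕ} (R : Type*) [CommRing R] (A : Matrix (Fin (n+1)) (Fin (n+1)) ℕ)
    (dT : ℕ) (ψ : R) : MvPolynomial (Fin (n+1)) R :=
  FA R A - MvPolynomial.C ((dT : R) * ψ) * ∏ j : Fin (n+1), X j


/-- The number of points of `ℙ^n(K)` at which the homogeneous polynomial `G`
vanishes. -/
def projCount (K : Type*) [Field K] {N : ℕ} (G : MvPolynomial (Fin N) K) : ℕ :=
  Nat.card { p : Projectivization K (Fin N → K) // MvPolynomial.eval p.rep G = 0 }

/-- The representative of `x` modulo `m` in `{1, …, m}` if `x ≠ 0`, and `0` if `x = 0`. -/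
def posMod (m x : ℕ) : ℕ := if x = 0 then 0 else (x - 1) % m + 1

lemma posMod_modEq (m x : ℕ) : posMod m x ≡ x [MOD m] := by
  unfold posMod
  split_ifs with h
  · rw [h]
  · obtain ⟨y, rfl⟩ := Nat.exists_eq_succ_of_ne_zero h
    exact (Nat.mod_modEq y m).add_right 1

lemma posMod_pos {m x : ℕ} (hx : 0 < x) : 0 < posMod m x := by
  unfold posMod
  split_ifs <;> omega

@[simp]
lemma posMod_zero (m : ℕ) : posMod m 0 = 0 := by simp [posMod]

lemma posMod_le_of_modEq {m x y : ℕ} (h : x ≡ y [MOD m]) (hy : 0 < y) : posMod m x ≤ y := by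
  unfold posMod
  split_ifs with hx
  · omega
  · obtain ⟨a, rfl⟩ := Nat.exists_eq_succ_of_ne_zero hx
    obtain ⟨b, rfl⟩ := Nat.exists_eq_succ_of_ne_zero hy.ne'
    have hab : a % m = b % m := Nat.ModEq.add_right_cancel' 1 h
    simp only [Nat.succ_sub_one, hab]
    exact Nat.succ_le_succ (Nat.mod_le b m)

lemma posMod_add_le (m a b : ℕ) : posMod m (a + b) ≤ posMod m a + posMod m b := by
  rcases Nat.eq_zero_or_pos (a + b) with h | h
  · simp [h]
  · refine posMod_le_of_modEq ((posMod_modEq m a).add (posMod_modEq m b)).symm ?_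
    rcases Nat.eq_zero_or_pos a with ha | ha
    · exact Nat.add_pos_right _ (posMod_pos (by omega))
    · exact Nat.add_pos_left (posMod_pos ha) _

lemma posMod_congr {m x y : ℕ} (h : x ≡ y [MOD m]) (hx : 0 < x) (hy : 0 < y) :
    posMod m x = posMod m y :=
  le_antisymm (posMod_le_of_modEq (h.trans (posMod_modEq m y).symm) (posMod_pos hy))
    (posMod_le_of_modEq (h.symm.trans (posMod_modEq m x).symm) (posMod_pos hx))

/-- The sum of `p ^ r * x` reduced modulo `p ^ f - 1`, over the cyclic shifts `r < f`. -/
def shiftSum (p f x : ℕ) : ℕ := ∑ r ∈ Finset.range f, posMod (p ^ f - 1) (p ^ r * x)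

lemma shiftSum_add_le (p f a b : ℕ) :
    shiftSum p f (a + b) ≤ shiftSum p f a + shiftSum p f b := by
  unfold shiftSum
  rw [← Finset.sum_add_distrib]
  refine Finset.sum_le_sum fun r _ => ?_
  rw [mul_add]
  exact posMod_add_le _ _ _

lemma pow_modEq_one (p f : ℕ) (hp : 0 < p) : p ^ f ≡ 1 [MOD p ^ f - 1] :=
  ((Nat.modEq_iff_dvd' (Nat.one_le_pow _ _ hp)).2 dvd_rfl).symm

lemma shiftSum_mul (p f x : ℕ) (hp : 0 < p) : shiftSum p f (p * x) = shiftSum p f x := by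
  rcases Nat.eq_zero_or_pos x with rfl | hx
  · simp
  unfold shiftSum
  have h1 := Finset.sum_range_succ (fun r => posMod (p ^ f - 1) (p ^ r * x)) f
  have h2 := Finset.sum_range_succ' (fun r => posMod (p ^ f - 1) (p ^ r * x)) f
  have h3 : posMod (p ^ f - 1) (p ^ f * x) = posMod (p ^ f - 1) (p ^ 0 * x) := by
    refine posMod_congr ?_ (by positivity) (by positivity)
    simpa using (pow_modEq_one p f hp).mul_right x
  have h4 : ∑ r ∈ Finset.range f, posMod (p ^ f - 1) (p ^ (r + 1) * x) =
      ∑ r ∈ Finset.range f, posMod (p ^ f - 1) (p ^ r * (p * x)) :=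
    Finset.sum_congr rfl fun r _ => by rw [pow_succ, mul_assoc]
  omega

lemma shiftSum_le_mul (p f d : ℕ) : shiftSum p f d ≤ d * shiftSum p f 1 := by
  induction d with
  | zero => simp [shiftSum]
  | succ d ih =>
    refine (shiftSum_add_le p f d 1).trans ?_
    rw [Nat.succ_mul]
    omega

lemma shiftSum_le_digits_sum (p f : ℕ) (hp : 1 < p) (x : ℕ) :
    shiftSum p f x ≤ (p.digits x).sum * shiftSum p f 1 := by
  induction x using Nat.strong_induction_on with
  | _ x ih =>
    rcases Nat.eq_zero_or_pos x with rfl | hx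
    · simp [shiftSum]
    rw [Nat.digits_def' hp hx, List.sum_cons, add_mul]
    calc shiftSum p f x = shiftSum p f (x % p + p * (x / p)) := by rw [Nat.mod_add_div]
      _ ≤ shiftSum p f (x % p) + shiftSum p f (p * (x / p)) := shiftSum_add_le _ _ _ _
      _ ≤ _ := by
        rw [shiftSum_mul p f _ (by omega)]
        exact add_le_add (shiftSum_le_mul _ _ _) (ih _ (Nat.div_lt_self hx hp))

lemma sub_one_mul_shiftSum_one_le (p f : ℕ) (hp : 1 < p) :
    (p - 1) * shiftSum p f 1 ≤ p ^ f - 1 := by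
  have h : shiftSum p f 1 ≤ ∑ r ∈ Finset.range f, p ^ r := by
    refine Finset.sum_le_sum fun r _ => ?_
    rw [mul_one]
    exact posMod_le_of_modEq rfl (by positivity)
  refine (Nat.mul_le_mul_left _ h).trans ?_
  rw [mul_comm, Nat.geomSum_eq hp]
  exact Nat.div_mul_le_self _ _

lemma digits_sum_le_of_lt_pow (p f x : ℕ) (hp : 1 < p) (hx : x < p ^ f) :
    (p.digits x).sum ≤ f * (p - 1) := by
  have h1 : (p.digits x).sum ≤ (p.digits x).length * (p - 1) := by
    rw [← smul_eq_mul]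
    exact List.sum_le_card_nsmul _ _ fun d hd => Nat.le_sub_one_of_lt (Nat.digits_lt_base hp hd)
  have h2 : (p.digits x).length ≤ f := (Nat.digits_length_le_iff hp x).2 hx
  exact h1.trans (Nat.mul_le_mul_right _ h2)

lemma digits_sum_pow_mul (p k x : ℕ) (hp : 1 < p) :
    (p.digits (p ^ k * x)).sum = (p.digits x).sum := by
  rcases Nat.eq_zero_or_pos x with rfl | hx
  · simp
  · simp [Nat.digits_base_pow_mul hp hx]

lemma padicValNat_prod {ι : Type*} (p : ℕ) [Fact p.Prime] (s : Finset ι) (g : ι → ℕ)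
    (hg : ∀ i ∈ s, g i ≠ 0) : padicValNat p (∏ i ∈ s, g i) = ∑ i ∈ s, padicValNat p (g i) := by
  classical
  induction s using Finset.induction_on with
  | empty => simp
  | insert a s ha ih =>
    rw [Finset.prod_insert ha, Finset.sum_insert ha, padicValNat.mul
      (hg a (Finset.mem_insert_self a s))
      (Finset.prod_ne_zero_iff.2 fun i hi => hg i (Finset.mem_insert_of_mem hi)),
      ih fun i hi => hg i (Finset.mem_insert_of_mem hi)]

/-- Legendre's formula for multinomial coefficients. -/
lemma sum_digits_sum_eq {ι : Type*} (p : ℕ) [hp : Fact p.Prime] (s : Finset ι) (w : ι → ℕ) :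
    ∑ i ∈ s, (p.digits (w i)).sum =
      (p - 1) * padicValNat p (Nat.multinomial s w) + (p.digits (∑ i ∈ s, w i)).sum := by
  have h := congrArg (fun a => (p - 1) * padicValNat p a) (Nat.multinomial_spec s w)
  have hne : Nat.multinomial s w ≠ 0 := (Nat.multinomial_pos s w).ne'
  rw [padicValNat.mul (Finset.prod_ne_zero_iff.2 fun i _ => Nat.factorial_ne_zero _) hne,
    padicValNat_prod p s _ fun i _ => Nat.factorial_ne_zero _, mul_add, Finset.mul_sum,
    sub_one_mul_padicValNat_factorial] at h
  simp only [sub_one_mul_padicValNat_factorial] at h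
  have h2 : ∑ i ∈ s, (w i - (p.digits (w i)).sum) + ∑ i ∈ s, (p.digits (w i)).sum =
      ∑ i ∈ s, w i := by
    rw [← Finset.sum_add_distrib]
    exact Finset.sum_congr rfl fun i _ => Nat.sub_add_cancel (Nat.digit_sum_le p (w i))
  have h3 := Nat.digit_sum_le p (∑ i ∈ s, w i)
  omega

/-- If the multinomial coefficient of `w` is not divisible by `p ^ f`, then the weights `w`
have a cyclic shift of small total size modulo `p ^ f - 1`. -/
lemma exists_sum_posMod_lt {ι : Type*} [Fintype ι] (p f k : ℕ) [hp : Fact p.Prime]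
    (w : ι → ℕ) (hw : ∑ i, w i = p ^ k * (p ^ f - 1))
    (hdvd : ¬ p ^ f ∣ Nat.multinomial Finset.univ w) :
    ∃ r, ∑ i, posMod (p ^ f - 1) (p ^ r * w i) < 2 * (p ^ f - 1) := by
  have hp1 : 1 < p := hp.out.one_lt
  have hv : padicValNat p (Nat.multinomial Finset.univ w) < f := by
    by_contra! h
    exact hdvd ((padicValNat_dvd_iff_le (Nat.multinomial_pos _ _).ne').2 h)
  have hf : 0 < f := by omega
  by_contra! hall
  have hsum := sum_digits_sum_eq p Finset.univ w
  rw [hw, digits_sum_pow_mul p k _ hp1] at hsum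
  have hM := digits_sum_le_of_lt_pow p f (p ^ f - 1) hp1
    (Nat.sub_lt (by positivity) one_pos)
  have hlt : ∑ i, (p.digits (w i)).sum < 2 * f * (p - 1) := by
    have : (p - 1) * padicValNat p (Nat.multinomial Finset.univ w) < (p - 1) * f :=
      Nat.mul_lt_mul_of_pos_left hv (by omega)
    nlinarith
  have hle : f * (2 * (p ^ f - 1)) ≤ (∑ i, (p.digits (w i)).sum) * shiftSum p f 1 := by
    calc f * (2 * (p ^ f - 1))
        = ∑ r ∈ Finset.range f, 2 * (p ^ f - 1) := by simp
      _ ≤ ∑ r ∈ Finset.range f, ∑ i, posMod (p ^ f - 1) (p ^ r * w i) :=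
        Finset.sum_le_sum fun r _ => hall r
      _ = ∑ i, shiftSum p f (w i) := Finset.sum_comm
      _ ≤ _ := by
        rw [Finset.sum_mul]
        exact Finset.sum_le_sum fun i _ => shiftSum_le_digits_sum p f hp1 _
  have hone := sub_one_mul_shiftSum_one_le p f hp1
  have hpos : 0 < shiftSum p f 1 := by
    refine Finset.sum_pos (fun r _ => posMod_pos (by positivity)) ?_
    simpa using hf.ne'
  have := Nat.mul_lt_mul_of_pos_right hlt hpos
  nlinarith

/-- The exponent of `x_j` in the product of the `w o`-th powers of the monomials with
exponents `E o`. -/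
def totalExp {ι κ : Type*} [Fintype ι] (E : ι → κ → ℕ) (w : ι → ℕ) (j : κ) : ℕ := ∑ o, w o * E o j

lemma totalExp_posMod_modEq {ι κ : Type*} [Fintype ι] (E : ι → κ → ℕ) (w : ι → ℕ) (m a : ℕ)
    (j : κ) : totalExp E (fun o => posMod m (a * w o)) j ≡ a * totalExp E w j [MOD m] := by
  unfold totalExp
  rw [Finset.mul_sum]
  refine Nat.ModEq.sum fun o _ => ?_
  rw [← mul_assoc]
  exact (posMod_modEq m _).mul_right _

lemma totalExp_posMod_pos_iff {ι κ : Type*} [Fintype ι] (E : ι → κ → ℕ) (w : ι → ℕ) (m a : ℕ)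
    (ha : 0 < a) (j : κ) :
    0 < totalExp E (fun o => posMod m (a * w o)) j ↔ 0 < totalExp E w j := by
  have h (o : ι) : 0 < posMod m (a * w o) ↔ 0 < w o := by
    refine ⟨fun h => ?_, fun h => posMod_pos (by positivity)⟩
    by_contra h0
    simp [Nat.eq_zero_of_not_pos h0] at h
  simp [totalExp, Finset.sum_pos_iff, h]

/-- All exponents of the monomial attached to `w` are positive multiples of `m`. -/
def Contributes {ι κ : Type*} [Fintype ι] (m : ℕ) (E : ι → κ → ℕ) (w : ι → ℕ) : Prop :=
  ∀ j, 0 < totalExp E w j ∧ m ∣ totalExp E w j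

lemma contributes_posMod_iff {ι κ : Type*} [Fintype ι] (m a : ℕ) (E : ι → κ → ℕ) (w : ι → ℕ)
    (ha : 0 < a) (hma : Nat.Coprime m a) :
    Contributes m E (fun o => posMod m (a * w o)) ↔ Contributes m E w := by
  refine forall_congr' fun j => and_congr (totalExp_posMod_pos_iff E w m a ha j) ?_
  rw [(totalExp_posMod_modEq E w m a j).dvd_iff dvd_rfl, hma.dvd_mul_left]

/-- The exponent vectors of the monomials of the pencil, with `none` standing for
the product of all variables. -/
def pencilExp {n : ℕ} (A : Matrix (Fin (n+1)) (Fin (n+1)) ℕ) :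
    Option (Fin (n+1)) → Fin (n+1) → ℕ
  | none, _ => 1
  | some i, j => A i j

lemma totalExp_pencilExp {n : ℕ} (A : Matrix (Fin (n+1)) (Fin (n+1)) ℕ)
    (w : Option (Fin (n+1)) → ℕ) (j : Fin (n+1)) :
    totalExp (pencilExp A) w j = w none + ∑ i, w (some i) * A i j := by
  simp [totalExp, Fintype.sum_option, pencilExp]

lemma sum_totalExp_pencilExp {n : ℕ} (A : Matrix (Fin (n+1)) (Fin (n+1)) ℕ)
    (hA : ∀ i, ∑ j, A i j = n + 1) (w : Option (Fin (n+1)) → ℕ) :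
    ∑ j, totalExp (pencilExp A) w j = (n + 1) * ∑ o, w o := by
  unfold totalExp
  rw [Finset.sum_comm, Finset.mul_sum]
  refine Finset.sum_congr rfl fun o _ => ?_
  rw [← Finset.mul_sum, mul_comm]
  cases o <;> simp [pencilExp, hA]

lemma totalExp_eq_of_dualWeights {n : ℕ} {A B : Matrix (Fin (n+1)) (Fin (n+1)) ℕ}
    (hdet : (A.map (Nat.cast : ℕ → ℚ)).det ≠ 0) {q : Fin (n+1) → ℕ}
    (hqA : HasDualWeights A q) (hqB : HasDualWeights B q) (w : Option (Fin (n+1)) → ℕ) (m : ℕ)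
    (h : ∀ j, totalExp (pencilExp A) w j = m) (j : Fin (n+1)) :
    totalExp (pencilExp B) w j = m := by
  simp only [totalExp_pencilExp] at h ⊢
  set d := ∑ j, q j with hd
  have hdpos : (d : ℚ) ≠ 0 := by
    have : 0 < d := Finset.sum_pos (fun i _ => hqA.1 i) Finset.univ_nonempty
    exact_mod_cast this.ne'
  have hq (C : Matrix (Fin (n+1)) (Fin (n+1)) ℕ) (hC : HasDualWeights C q) (j : Fin (n+1)) :
      ∑ i, (q i : ℚ) * C i j = d := by
    have := hC.2.2 j
    simp_rw [mul_comm] at this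
    exact_mod_cast this
  have hv : Matrix.vecMul (fun i => (d : ℚ) * w (some i) - (m - w none) * q i)
      (A.map (Nat.cast : ℕ → ℚ)) = 0 := by
    ext j
    have hj : (w none : ℚ) + ∑ i, (w (some i) : ℚ) * A i j = m := by exact_mod_cast h j
    simp only [Matrix.vecMul, dotProduct, Matrix.map_apply, sub_mul, Finset.sum_sub_distrib,
      mul_assoc, ← Finset.mul_sum, hq A hqA j, Pi.zero_apply]
    linear_combination (d : ℚ) * hj
  have hw (i : Fin (n+1)) : (d : ℚ) * w (some i) = (m - w none) * q i :=
    sub_eq_zero.1 (congrFun (Matrix.eq_zero_of_vecMul_eq_zero hdet hv) i)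
  have key : (d : ℚ) * ((w none : ℚ) + ∑ i, (w (some i) : ℚ) * B i j) = d * m := by
    rw [mul_add, Finset.mul_sum]
    simp_rw [← mul_assoc, hw, mul_assoc]
    rw [← Finset.mul_sum, hq B hqB j]
    ring
  exact_mod_cast mul_left_cancel₀ hdpos key

/-- Up to terms with multinomial coefficient divisible by `p ^ f`, the contributing monomials
depend only on the dual weights. -/
lemma Contributes.of_dualWeights {n : ℕ} {A B : Matrix (Fin (n+1)) (Fin (n+1)) ℕ}
    (hdet : (A.map (Nat.cast : ℕ → ℚ)).det ≠ 0) (hA : ∀ i, ∑ j, A i j = n + 1)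
    {q : Fin (n+1) → ℕ} (hqA : HasDualWeights A q) (hqB : HasDualWeights B q)
    {p f k : ℕ} [hp : Fact p.Prime] {w : Option (Fin (n+1)) → ℕ}
    (hw : ∑ o, w o = p ^ k * (p ^ f - 1)) (hf : f ≠ 0)
    (hdvd : ¬ p ^ f ∣ Nat.multinomial Finset.univ w)
    (h : Contributes (p ^ f - 1) (pencilExp A) w) :
    Contributes (p ^ f - 1) (pencilExp B) w := by
  obtain ⟨r, hr⟩ := exists_sum_posMod_lt p f k w hw hdvd
  have hp1 := hp.out.one_lt
  have hm : 0 < p ^ f - 1 := Nat.sub_pos_of_lt (Nat.one_lt_pow hf hp1)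
  have hcop : Nat.Coprime (p ^ f - 1) (p ^ r) := by
    refine Nat.Coprime.pow_right r (Nat.Coprime.coprime_dvd_right (dvd_pow_self p hf) ?_)
    have := Nat.coprime_self_sub_left (Nat.one_le_pow f p (by omega))
    simpa using this
  have hpr : 0 < p ^ r := by positivity
  rw [← contributes_posMod_iff _ _ _ _ hpr hcop] at h ⊢
  set m := p ^ f - 1
  set w' : Option (Fin (n+1)) → ℕ := fun o => posMod m (p ^ r * w o)
  have hsum : ∑ o, w' o ≤ m := by
    have h1 : ∑ o, w' o ≡ 0 [MOD m] := by
      have : ∑ o, w' o ≡ ∑ o, p ^ r * w o [MOD m] := Nat.ModEq.sum fun o _ => posMod_modEq m _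
      refine this.trans ?_
      rw [← Finset.mul_sum, hw]
      exact (Nat.modEq_zero_iff_dvd).2 (Dvd.intro_left _ (by rw [mul_assoc]))
    obtain ⟨c, hc⟩ := (Nat.modEq_zero_iff_dvd).1 h1
    rw [hc, mul_comm] at hr ⊢
    have : c < 2 := Nat.lt_of_mul_lt_mul_right hr
    nlinarith
  have hge (j : Fin (n+1)) : m ≤ totalExp (pencilExp A) w' j := Nat.le_of_dvd (h j).1 (h j).2
  have heq (j : Fin (n+1)) : totalExp (pencilExp A) w' j = m := by
    have h1 : ∑ j : Fin (n+1), totalExp (pencilExp A) w' j = ∑ j : Fin (n+1), m := by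
      refine le_antisymm ?_ (Finset.sum_le_sum fun j _ => hge j)
      rw [sum_totalExp_pencilExp A hA]
      simpa using Nat.mul_le_mul_left (n + 1) hsum
    exact ((Finset.sum_eq_sum_iff_of_le fun j _ => hge j).1 h1.symm j (Finset.mem_univ j)).symm
  intro j
  rw [totalExp_eq_of_dualWeights hdet hqA hqB w' m heq j]
  exact ⟨hm, dvd_rfl⟩

/-- `projCount` counts the nonzero affine zeros up to scaling. -/
lemma projCount_mul_card_units (K : Type*) [Field K] {N m : ℕ}
    (G : MvPolynomial (Fin N) K)
    (hG : ∀ (c : K) (v : Fin N → K), MvPolynomial.eval (c • v) G = c ^ m * MvPolynomial.eval v G) :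
    Nat.card {v : Fin N → K // v ≠ 0 ∧ MvPolynomial.eval v G = 0} =
      projCount K G * Nat.card Kˣ := by
  have heval (u : Kˣ) (v : Fin N → K) :
      MvPolynomial.eval (u • v) G = 0 ↔ MvPolynomial.eval v G = 0 := by
    have : MvPolynomial.eval (u • v) G = (u : K) ^ m * MvPolynomial.eval v G := hG u v
    rw [this]
    simp
  rw [projCount, ← Nat.card_prod]
  refine (Nat.card_eq_of_bijective
    (fun x : {p : Projectivization K (Fin N → K) // MvPolynomial.eval p.rep G = 0} × Kˣ =>
      (⟨x.2 • x.1.1.rep, (smul_ne_zero_iff_ne x.2).2 x.1.1.rep_nonzero, (heval _ _).2 x.1.2⟩ :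
        {v : Fin N → K // v ≠ 0 ∧ MvPolynomial.eval v G = 0})) ⟨?_, ?_⟩).symm
  · rintro ⟨⟨a, ha⟩, u⟩ ⟨⟨b, hb⟩, v⟩ h
    have h' : u • a.rep = v • b.rep := congrArg Subtype.val h
    have hab : a = b := by
      rw [← a.mk_rep, ← b.mk_rep]
      refine (Projectivization.mk_eq_mk_iff K _ _ a.rep_nonzero b.rep_nonzero).2 ⟨u⁻¹ * v, ?_⟩
      rw [mul_smul, ← h', inv_smul_smul]
    subst hab
    have huv : u = v := Units.ext (smul_left_injective K a.rep_nonzero h')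
    rw [huv]
  · rintro ⟨v, hv, hz⟩
    obtain ⟨a, ha⟩ := Projectivization.exists_smul_eq_mk_rep K v hv
    refine ⟨⟨⟨Projectivization.mk K v hv, ?_⟩, a⁻¹⟩, ?_⟩
    · rw [← ha]
      exact (heval a v).2 hz
    · simp [← ha]

lemma projCount_modEq_of_affine (K : Type*) [Field K] [Fintype K] {N m : ℕ}
    (G H : MvPolynomial (Fin N) K)
    (hG : ∀ (c : K) (v : Fin N → K), MvPolynomial.eval (c • v) G = c ^ m * MvPolynomial.eval v G)
    (hH : ∀ (c : K) (v : Fin N → K), MvPolynomial.eval (c • v) H = c ^ m * MvPolynomial.eval v H)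
    (hm : m ≠ 0)
    (h : Nat.card {v : Fin N → K // MvPolynomial.eval v G = 0} ≡
      Nat.card {v : Fin N → K // MvPolynomial.eval v H = 0} [MOD Fintype.card K]) :
    projCount K G ≡ projCount K H [MOD Fintype.card K] := by
  classical
  have key (G : MvPolynomial (Fin N) K)
    (hG : ∀ (c : K) (v : Fin N → K), MvPolynomial.eval (c • v) G = c ^ m * MvPolynomial.eval v G) :
      (Nat.card {v : Fin N → K // MvPolynomial.eval v G = 0} : ℤ) =
        projCount K G * (Fintype.card K - 1) + 1 := by
    have h0 : MvPolynomial.eval 0 G = 0 := by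
      simpa [hm] using hG 0 0
    have h1 := projCount_mul_card_units K G hG
    rw [Nat.card_units, Nat.card_eq_fintype_card (α := K)] at h1
    have h2 : Nat.card {v : Fin N → K // MvPolynomial.eval v G = 0} =
        Nat.card {v : Fin N → K // v ≠ 0 ∧ MvPolynomial.eval v G = 0} + 1 := by
      simp only [Nat.card_eq_fintype_card, Fintype.card_subtype]
      rw [← Finset.card_erase_add_one (a := (0 : Fin N → K)) (by simpa using h0)]
      congr 2
      ext v
      simp
    rw [h2, h1]
    have := Fintype.card_pos (α := K)
    push_cast [Nat.cast_sub this]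
    ring
  rw [← Int.natCast_modEq_iff, key G hG, key H hH] at h
  rw [← Int.natCast_modEq_iff]
  rw [Int.modEq_iff_dvd] at h ⊢
  obtain ⟨c, hc⟩ := h
  exact ⟨projCount K H - projCount K G - c, by linear_combination -hc⟩

lemma eval_pencil {n : ℕ} (R : Type*) [CommRing R]
    (A : Matrix (Fin (n+1)) (Fin (n+1)) ℕ) (d : ℕ) (ψ : R) (v : Fin (n+1) → R) :
    MvPolynomial.eval v (pencil R A d ψ) =
      ∑ i, ∏ j, v j ^ A i j - d * ψ * ∏ j, v j := by
  simp [pencil, FA]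

lemma eval_smul_pencil {n : ℕ} (R : Type*) [CommRing R]
    (A : Matrix (Fin (n+1)) (Fin (n+1)) ℕ) (hA : ∀ i, ∑ j, A i j = n + 1) (d : ℕ) (ψ : R)
    (c : R) (v : Fin (n+1) → R) :
    MvPolynomial.eval (c • v) (pencil R A d ψ) =
      c ^ (n + 1) * MvPolynomial.eval v (pencil R A d ψ) := by
  simp only [eval_pencil, Pi.smul_apply, smul_eq_mul, mul_pow, Finset.prod_mul_distrib,
    Finset.prod_pow_eq_pow_sum, hA, Finset.prod_const, Finset.card_univ, Fintype.card_fin,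
    mul_sub, Finset.mul_sum]
  ring

lemma sum_pow_sum_mul_prod {R S : Type*} [CommSemiring R] [Fintype S]
    {ι κ : Type*} [Fintype ι] [Fintype κ] [DecidableEq ι] [DecidableEq κ]
    (g : S → R) (E : ι → κ → ℕ) (C : ι → R) (M : ℕ) :
    ∑ x : κ → S, (∑ o, C o * ∏ j, g (x j) ^ E o j) ^ M =
      ∑ w ∈ Finset.univ.piAntidiag M, (Nat.multinomial Finset.univ w : R) *
        ((∏ o, C o ^ w o) *
          ∏ j, ∑ t : S, g t ^ totalExp E w j) := by
  simp_rw [Finset.sum_pow_eq_sum_piAntidiag]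
  rw [Finset.sum_comm]
  refine Finset.sum_congr rfl fun w _ => ?_
  rw [← Finset.mul_sum]
  congr 1
  simp_rw [mul_pow, Finset.prod_mul_distrib]
  rw [← Finset.mul_sum]
  congr 1
  rw [Finset.prod_univ_sum, Fintype.piFinset_univ]
  refine Finset.sum_congr rfl fun x _ => ?_
  simp_rw [← Finset.prod_pow]
  rw [Finset.prod_comm]
  refine Finset.prod_congr rfl fun j _ => ?_
  simp_rw [← pow_mul, Finset.prod_pow_eq_pow_sum, totalExp, mul_comm]

section Witt

variable (p : ℕ) [hp : Fact p.Prime] (F : Type*) [Field F]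

local notation "𝕎" => WittVector p

/-- The coefficients of the Teichmüller lift of the pencil. -/
def liftCoeff {n : ℕ} (d : ℕ) (ψ : F) : Option (Fin (n+1)) → 𝕎 F
  | none => -(d * WittVector.teichmuller p ψ)
  | some _ => 1

lemma constantCoeff_lift_pencil {n : ℕ} (A : Matrix (Fin (n+1)) (Fin (n+1)) ℕ) (d : ℕ)
    (ψ : F) (x : Fin (n+1) → F) :
    WittVector.constantCoeff (∑ o, liftCoeff p F d ψ o *
      ∏ j, WittVector.teichmuller p (x j) ^ pencilExp A o j) =
      MvPolynomial.eval x (pencil F A d ψ) := by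
  have hτ (a : F) : WittVector.constantCoeff (WittVector.teichmuller p a) = a :=
    WittVector.teichmuller_coeff_zero p a
  rw [eval_pencil, Fintype.sum_option]
  simp only [liftCoeff, pencilExp, map_add, map_neg, map_mul, map_sum, map_prod, map_pow, hτ,
    map_natCast, one_mul, pow_one]
  ring

variable [CharP F p]

lemma natCast_p_dvd_iff [PerfectRing F p] (x : 𝕎 F) :
    (p : 𝕎 F) ∣ x ↔ WittVector.constantCoeff x = 0 := by
  rw [← Ideal.mem_span_singleton, ← WittVector.ker_constantCoeff, RingHom.mem_ker]

lemma pow_dvd_of_wittVector_pow_dvd [PerfectRing F p] (f : ℕ) (z : ℤ)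
    (h : (p : 𝕎 F) ^ f ∣ (z : 𝕎 F)) : (p : ℤ) ^ f ∣ z := by
  have hgcd : (p : 𝕎 F) ^ f ∣ ((Int.gcd z (p ^ f) : ℤ) : 𝕎 F) := by
    rw [Int.gcd_eq_gcd_ab]
    push_cast
    exact dvd_add (h.mul_right _) (dvd_mul_right _ _)
  obtain ⟨v, hv, hgv⟩ := (Nat.dvd_prime_pow hp.out).1
    (show Int.gcd z (p ^ f) ∣ p ^ f by
      have := Int.gcd_dvd_right z ((p : ℤ) ^ f)
      exact_mod_cast this)
  rw [hgv] at hgcd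
  push_cast at hgcd
  have hp0 : (p : 𝕎 F) ≠ 0 := WittVector.p_nonzero p F
  have hpu : ¬ IsUnit (p : 𝕎 F) := fun hu => by
    have := hu.map (WittVector.constantCoeff (R := F) (p := p))
    simp at this
  have hfv := (pow_dvd_pow_iff hp0 hpu).1 hgcd
  have hle := Int.gcd_dvd_left z ((p : ℤ) ^ f)
  rw [hgv, le_antisymm hv hfv] at hle
  exact_mod_cast hle

variable [Fintype F]

/-- Power sums over the Teichmüller representatives of a finite field. -/
lemma sum_teichmuller_pow [DecidableEq F] (e : ℕ) :
    ∑ t : F, WittVector.teichmuller p t ^ e =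
      (if Fintype.card F - 1 ∣ e then ((Fintype.card F - 1 : ℕ) : 𝕎 F) else 0) + 0 ^ e := by
  classical
  have h0 : ∑ t : F, WittVector.teichmuller p t ^ e =
      ∑ u : Fˣ, WittVector.teichmuller p (u : F) ^ e + 0 ^ e := by
    rw [← Finset.sum_erase_add _ _ (Finset.mem_univ (0 : F)), WittVector.teichmuller_zero]
    congr 1
    refine (Finset.sum_bij (fun (u : Fˣ) _ => (u : F)) ?_ ?_ ?_ ?_).symm
    · simp
    · intro a _ b _ hab
      exact Units.ext hab
    · intro b hb
      exact ⟨Units.mk0 b (Finset.ne_of_mem_erase hb), Finset.mem_univ _, rfl⟩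
    · simp
  let χ : Fˣ →* 𝕎 F :=
    (powMonoidHom e).comp ((WittVector.teichmuller p).comp (Units.coeHom F))
  have hχ : χ = 1 ↔ Fintype.card F - 1 ∣ e := by
    rw [← FiniteField.forall_pow_eq_one_iff, MonoidHom.ext_iff]
    refine forall_congr' fun u => ?_
    have hinj : Function.Injective (WittVector.teichmuller p : F → 𝕎 F) := fun a b hab => by
      simpa using congrArg (fun z : 𝕎 F => z.coeff 0) hab
    have : χ u = WittVector.teichmuller p ((u ^ e : Fˣ) : F) := by simp [χ]
    rw [this, MonoidHom.one_apply, ← map_one (WittVector.teichmuller p), hinj.eq_iff,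
      Units.val_eq_one]
  have h1 := sum_hom_units χ
  rw [h0]
  congr 1
  refine Eq.trans ?_ (h1.trans ?_)
  · rfl
  · simp only [hχ, Fintype.card_units]
    split_ifs <;> simp

lemma pow_dvd_pow_sub_indicator [DecidableEq F] [PerfectRing F p] {f : ℕ}
    (hcard : Fintype.card F = p ^ f) (z : 𝕎 F) :
    (p : 𝕎 F) ^ f ∣ z ^ (p ^ f * (p ^ f - 1)) -
      (if WittVector.constantCoeff z = 0 then 0 else 1) := by
  have hp1 := hp.out.one_lt
  have hlt : f < p ^ f := Nat.lt_pow_self hp1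
  have hq : 0 < p ^ f - 1 := by
    rw [← hcard]
    exact Nat.sub_pos_of_lt Fintype.one_lt_card
  split_ifs with h
  · rw [sub_zero]
    refine dvd_trans (pow_dvd_pow _ (hlt.le.trans (Nat.le_mul_of_pos_right _ hq)))
      (pow_dvd_pow_of_dvd ((natCast_p_dvd_iff p F z).2 h) _)
  · have h1 : (p : 𝕎 F) ∣ z ^ (p ^ f - 1) - 1 := by
      rw [natCast_p_dvd_iff, map_sub, map_pow, map_one, ← hcard,
        FiniteField.pow_card_sub_one_eq_one _ h, sub_self]
    have h2 := dvd_sub_pow_of_dvd_sub h1 f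
    rw [one_pow, ← pow_mul, mul_comm] at h2
    exact (pow_dvd_pow _ (Nat.le_succ f)).trans h2

open Classical in
lemma pow_dvd_prod_sum_teichmuller_sub [DecidableEq F] {f : ℕ}
    (hcard : Fintype.card F = p ^ f) {ι κ : Type*} [Fintype ι] [Fintype κ]
    (E : ι → κ → ℕ) (w : ι → ℕ) :
    (p : 𝕎 F) ^ f ∣ ∏ j, ∑ t : F, WittVector.teichmuller p t ^ totalExp E w j -
      (if Contributes (p ^ f - 1) E w then
        ((p ^ f - 1 : ℕ) : 𝕎 F) ^ Fintype.card κ else 0) := by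
  have hone : 1 ≤ p ^ f := Nat.one_le_pow _ _ hp.out.pos
  simp_rw [sum_teichmuller_pow, hcard]
  split_ifs with h
  · rw [Finset.prod_congr rfl (g := fun _ => ((p ^ f - 1 : ℕ) : 𝕎 F))]
    · simp
    · intro j _
      simp [(h j).1.ne', (h j).2]
  · rw [sub_zero]
    simp only [Contributes, not_forall] at h
    obtain ⟨j, hj⟩ := h
    refine dvd_trans ?_ (Finset.dvd_prod_of_mem _ (Finset.mem_univ j))
    rcases Nat.eq_zero_or_pos (totalExp E w j) with h0 | h0
    · rw [h0]
      push_cast [Nat.cast_sub hone]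
      simp
    · have : ¬ p ^ f - 1 ∣ totalExp E w j := fun hd => hj ⟨h0, hd⟩
      simp [this, h0.ne']

lemma pow_dvd_sum_pow_sub_sum_pow [DecidableEq F] {f : ℕ}
    (hcard : Fintype.card F = p ^ f) {ι κ : Type*} [Fintype ι] [Fintype κ]
    [DecidableEq ι] [DecidableEq κ] (E E' : ι → κ → ℕ) (C : ι → 𝕎 F) (M : ℕ)
    (h : ∀ w : ι → ℕ, ∑ o, w o = M → ¬ p ^ f ∣ Nat.multinomial Finset.univ w →
      (Contributes (p ^ f - 1) E w ↔ Contributes (p ^ f - 1) E' w)) :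
    (p : 𝕎 F) ^ f ∣
      ∑ x : κ → F, (∑ o, C o * ∏ j, WittVector.teichmuller p (x j) ^ E o j) ^ M -
      ∑ x : κ → F, (∑ o, C o * ∏ j, WittVector.teichmuller p (x j) ^ E' o j) ^ M := by
  classical
  rw [sum_pow_sum_mul_prod, sum_pow_sum_mul_prod, ← Finset.sum_sub_distrib]
  refine Finset.dvd_sum fun w hw => ?_
  rw [← mul_sub, ← mul_sub]
  by_cases hd : p ^ f ∣ Nat.multinomial Finset.univ w
  · refine Dvd.dvd.mul_right ?_ _
    exact_mod_cast Nat.cast_dvd_cast (α := 𝕎 F) hd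
  · refine Dvd.dvd.mul_left (Dvd.dvd.mul_left ?_ _) _
    have h1 := pow_dvd_prod_sum_teichmuller_sub p F hcard E w
    have h2 := pow_dvd_prod_sum_teichmuller_sub p F hcard E' w
    rw [← h w (Finset.mem_piAntidiag.1 hw).1 hd] at h2
    simpa using dvd_sub h1 h2

lemma pow_dvd_sum_lift_pencil_sub [DecidableEq F] [PerfectRing F p] {f : ℕ}
    (hcard : Fintype.card F = p ^ f) {n : ℕ} (A : Matrix (Fin (n+1)) (Fin (n+1)) ℕ) (d : ℕ)
    (ψ : F) :
    (p : 𝕎 F) ^ f ∣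
      ∑ x : Fin (n+1) → F, (∑ o, liftCoeff p F d ψ o *
        ∏ j, WittVector.teichmuller p (x j) ^ pencilExp A o j) ^ (p ^ f * (p ^ f - 1)) -
      (Fintype.card (Fin (n+1) → F) -
        Nat.card {v : Fin (n+1) → F // MvPolynomial.eval v (pencil F A d ψ) = 0}) := by
  have hcount : ∑ x : Fin (n+1) → F,
      (if MvPolynomial.eval x (pencil F A d ψ) = 0 then (0 : 𝕎 F) else 1) =
      Fintype.card (Fin (n+1) → F) -
        Nat.card {v : Fin (n+1) → F // MvPolynomial.eval v (pencil F A d ψ) = 0} := by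
    rw [Nat.card_eq_fintype_card, Fintype.card_subtype, eq_sub_iff_add_eq, Finset.card_filter,
      Nat.cast_sum, ← Finset.sum_add_distrib, Finset.sum_congr rfl (g := fun _ => (1 : 𝕎 F))]
    · simp [Finset.card_univ]
    · intro x _
      split_ifs <;> simp
  rw [← hcount, ← Finset.sum_sub_distrib]
  refine Finset.dvd_sum fun x _ => ?_
  rw [← constantCoeff_lift_pencil p F A d ψ x]
  exact pow_dvd_pow_sub_indicator p F hcard _

end Witt

/-- invertible pencils with the same dual weights have point counts
congruent modulo `q`. -/
theorem point_count_congruence (n : ℕ) (hn : 2 ≤ n)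
    (A B : Matrix (Fin (n+1)) (Fin (n+1)) ℕ)
    (hA : IsInvertibleCY A) (hB : IsInvertibleCY B)
    (q : Fin (n+1) → ℕ)
    (hqA : HasDualWeights A q) (hqB : HasDualWeights B q)
    (F : Type) [Field F] [Fintype F] (ψ : F) :
    projCount F (pencil F A (∑ j, q j) ψ) ≡ projCount F (pencil F B (∑ j, q j) ψ)
      [MOD Fintype.card F] := by
  classical
  obtain ⟨p, hchar⟩ := CharP.exists F
  obtain ⟨f, hp, hcard⟩ := FiniteField.card F p
  have : Fact p.Prime := ⟨hp⟩
  refine projCount_modEq_of_affine F _ _ (eval_smul_pencil F A hA.2.1 _ ψ)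
    (eval_smul_pencil F B hB.2.1 _ ψ) n.succ_ne_zero ?_
  have h := pow_dvd_sum_pow_sub_sum_pow p F hcard (pencilExp A) (pencilExp B)
    (liftCoeff p F (∑ j, q j) ψ) (p ^ (f : ℕ) * (p ^ (f : ℕ) - 1)) fun w hw hdvd =>
      ⟨Contributes.of_dualWeights hA.1 hA.2.1 hqA hqB hw f.ne_zero hdvd,
        Contributes.of_dualWeights hB.1 hB.2.1 hqB hqA hw f.ne_zero hdvd⟩
  have h1 := pow_dvd_sum_lift_pencil_sub p F hcard A (∑ j, q j) ψ
  have h2 := pow_dvd_sum_lift_pencil_sub p F hcard B (∑ j, q j) ψ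
  rw [← Int.natCast_modEq_iff, Int.modEq_iff_dvd, hcard, Nat.cast_pow]
  refine pow_dvd_of_wittVector_pow_dvd p F f _ ?_
  have h3 := dvd_add (dvd_sub h2 h1) h
  push_cast at h3 ⊢
  convert h3 using 1
  ring

end
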